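/- Let G be a finite simple graph with m ≥ 2 edges and with t(G) > 0. Then λ₁² + λ₂² < m + (3·t(G))^(2/3), i.e., the inequality is strict. -/

import Mathlib

/-- The adjacency matrix of a simple graph over `ℝ` is Hermitian (symmetric). -/
lemma adjMatrix_isHermitian {V : Type*} [Fintype V] (G : SimpleGraph V)
    [DecidableRel G.Adj] : (G.adjMatrix ℝ).IsHermitian := by
  rw [Matrix.IsHermitian, Matrix.conjTranspose_eq_transpose_of_trivial]
  exact G.isSymm_adjMatrix


lemma aux_cubes {ι : Type*} (T : Finset ι) (f : ι → ℝ) (r : ℝ) (hr : 0 ≤ r)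
    (h : ∑ i ∈ T, f i ^ 2 = r ^ 2) : ∑ i ∈ T, |f i| ^ 3 ≤ r ^ 3 := by
  have h1 : ∀ i ∈ T, |f i| ^ 3 ≤ r * f i ^ 2 := by
    intro i hi
    have h2 : f i ^ 2 ≤ r ^ 2 := by
      rw [← h]
      exact Finset.single_le_sum (f := fun i => f i ^ 2) (fun j _ => sq_nonneg _) hi
    have h3 : |f i| ≤ r := abs_le_of_sq_le_sq h2 hr
    have : |f i| ^ 3 = |f i| * f i ^ 2 := by rw [← sq_abs (f i)]; ring
    rw [this]
    exact mul_le_mul_of_nonneg_right h3 (sq_nonneg _)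
  calc _ ≤ ∑ i ∈ T, r * f i ^ 2 := Finset.sum_le_sum h1
    _ = r ^ 3 := by rw [← Finset.mul_sum, h]; ring

lemma aux_chord (a q x : ℝ) (hq : 0 ≤ q) (ha : 0 < a) (hx : q ≤ x) (hxa : x ≤ a) :
    (a + q) * x ^ 3 ≤ (a + q) * q ^ 3 + (a ^ 2 + a * q + q ^ 2) * (x ^ 2 - q ^ 2) := by
  have : 0 ≤ (x - q) * ((a - x) * (a * x + a * q + x * q)) := by
    apply mul_nonneg (by linarith)
    apply mul_nonneg (by linarith)
    have : 0 ≤ x := by linarith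
    positivity
  nlinarith [this]

lemma aux_cubes2 {ι : Type*} [DecidableEq ι] (T : Finset ι) (f : ι → ℝ) (a q : ℝ) (ha : 0 < a)
    (hq : 0 ≤ q) (hqa : q ≤ a) (hf : ∀ i ∈ T, |f i| ≤ a)
    (h : ∑ i ∈ T, f i ^ 2 = a ^ 2 + q ^ 2) : ∑ i ∈ T, |f i| ^ 3 ≤ a ^ 3 + q ^ 3 := by
  by_cases hc : ∀ i ∈ T, |f i| ≤ q
  · have h1 : ∀ i ∈ T, |f i| ^ 3 ≤ q * f i ^ 2 := by
      intro i hi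
      have : |f i| ^ 3 = |f i| * f i ^ 2 := by rw [← sq_abs (f i)]; ring
      rw [this]
      exact mul_le_mul_of_nonneg_right (hc i hi) (sq_nonneg _)
    calc _ ≤ ∑ i ∈ T, q * f i ^ 2 := Finset.sum_le_sum h1
      _ = q * (a ^ 2 + q ^ 2) := by rw [← Finset.mul_sum, h]
      _ ≤ _ := by nlinarith [mul_nonneg (sub_nonneg.2 hqa) (sq_nonneg a)]
  · push Not at hc
    obtain ⟨j, hj, hjq⟩ := hc
    have hja := hf j hj
    set M := |f j| with hM
    have hM2 : M ^ 2 = f j ^ 2 := sq_abs _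
    have e2 := Finset.add_sum_erase T (fun i => f i ^ 2) hj
    have e3 := Finset.add_sum_erase T (fun i => |f i| ^ 3) hj
    have hp0 : 0 ≤ a ^ 2 + q ^ 2 - M ^ 2 := by nlinarith
    set p := √(a ^ 2 + q ^ 2 - M ^ 2) with hp
    have hpp : p ^ 2 = a ^ 2 + q ^ 2 - M ^ 2 := Real.sq_sqrt hp0
    have hpn : 0 ≤ p := Real.sqrt_nonneg _
    have hpq : q ≤ p := by
      apply le_of_sq_le_sq _ hpn
      nlinarith
    have hpa : p ≤ a := by
      apply le_of_sq_le_sq _ ha.le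
      nlinarith
    have b1 := aux_cubes (T.erase j) f p hpn (by linarith)
    have c1 := aux_chord a q p hq ha hpq hpa
    have c2 := aux_chord a q M hq ha hjq.le hja
    have : (a + q) * (M ^ 3 + p ^ 3) ≤ (a + q) * (a ^ 3 + q ^ 3) := by
      have : M ^ 2 = a ^ 2 + q ^ 2 - p ^ 2 := by linarith
      rw [this] at c2
      nlinarith
    have := le_of_mul_le_mul_left this (by linarith)
    linarith

lemma aux_pos {ι : Type*} [DecidableEq ι] (T : Finset ι) (f : ι → ℝ) (a b s m : ℝ)
    (ha : 0 ≤ a) (hb : 0 ≤ b) (hba : b ≤ a) (hs : 0 < s) (hf : ∀ i ∈ T, |f i| ≤ a)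
    (h1 : a + b + ∑ i ∈ T, f i = 0) (h2 : a ^ 2 + b ^ 2 + ∑ i ∈ T, f i ^ 2 = 2 * m)
    (h3 : a ^ 3 + b ^ 3 + ∑ i ∈ T, f i ^ 3 ≤ 2 * s ^ 3) : a ^ 2 + b ^ 2 < m + s ^ 2 := by
  by_contra! hc
  have hneg : - ∑ i ∈ T, f i ^ 3 ≤ ∑ i ∈ T, |f i| ^ 3 := by
    rw [← Finset.sum_neg_distrib]
    apply Finset.sum_le_sum
    intro i _
    rw [← abs_pow]
    exact neg_le_abs _
  set R := ∑ i ∈ T, f i ^ 2 with hR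
  have hR0 : 0 ≤ R := Finset.sum_nonneg fun i _ => sq_nonneg _
  have hle : R + 2 * s ^ 2 ≤ a ^ 2 + b ^ 2 := by linarith
  by_cases hRa : R ≤ a ^ 2
  · set r := √R
    have hrr : r ^ 2 = R := Real.sq_sqrt hR0
    have hr : 0 ≤ r := Real.sqrt_nonneg _
    have k1 := aux_cubes T f r hr (by rw [hrr])
    have hra : r ≤ a := le_of_sq_le_sq (by linarith) ha
    set e := √(a ^ 2 - r ^ 2)
    have hee : e ^ 2 = a ^ 2 - r ^ 2 := Real.sq_sqrt (by linarith)
    have he : 0 ≤ e := Real.sqrt_nonneg _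
    have hea : e ≤ a := le_of_sq_le_sq (by nlinarith) ha
    have k2 : 0 ≤ (a - r) * r ^ 2 := mul_nonneg (by linarith) (sq_nonneg _)
    have k3 : 0 ≤ (a - e) * e ^ 2 := mul_nonneg (by linarith) (sq_nonneg _)
    have k4 : a ^ 3 = a * r ^ 2 + a * e ^ 2 := by rw [hee]; ring
    have k5 : 0 ≤ (e - s) ^ 2 * (2 * e + s) := by positivity
    have k6 : 0 ≤ (b - s) ^ 2 * (2 * b + s) := by positivity
    have k7 : 0 ≤ s * (e ^ 2 + b ^ 2 - 2 * s ^ 2) := mul_nonneg hs.le (by linarith)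
    have z3 : (a - e) * e ^ 2 = 0 := by nlinarith
    have z5 : (e - s) ^ 2 * (2 * e + s) = 0 := by nlinarith
    have ee : e = s := by
      rcases mul_eq_zero.1 z5 with h | h
      · have := pow_eq_zero_iff (two_ne_zero) |>.1 h
        linarith
      · linarith
    have ae : a = e := by
      rcases mul_eq_zero.1 z3 with h | h
      · linarith
      · have := pow_eq_zero_iff (two_ne_zero) |>.1 h
        linarith
    have r0 : R = 0 := by rw [← ae] at hee; linarith
    have f0 := (Finset.sum_eq_zero_iff_of_nonneg (fun i _ => sq_nonneg (f i))).1 (hR ▸ r0)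
    have : ∑ i ∈ T, f i = 0 := Finset.sum_eq_zero fun i hi => by
      exact pow_eq_zero_iff (two_ne_zero) |>.1 (f0 i hi)
    linarith
  · push Not at hRa
    have apos : 0 < a := by
      rcases ha.eq_or_lt with h | h
      · exfalso
        have : b = 0 := by linarith
        subst this; subst h; nlinarith [sq_pos_of_pos hs]
      · exact h
    set q := √(R - a ^ 2)
    have hqq : q ^ 2 = R - a ^ 2 := Real.sq_sqrt (by linarith)
    have hq : 0 ≤ q := Real.sqrt_nonneg _
    have hqb : q ≤ b := le_of_sq_le_sq (by nlinarith) hb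
    have k1 := aux_cubes2 T f a q apos hq (by linarith) hf (by linarith)
    have hsb : s < b := by
      apply lt_of_pow_lt_pow_left₀ 2 hb
      nlinarith [sq_pos_of_pos hs]
    have k2 : b * (q ^ 2 + 2 * s ^ 2) ≤ b * b ^ 2 := mul_le_mul_of_nonneg_left (by linarith) hb
    have k3 : 0 ≤ (b - q) * q ^ 2 := mul_nonneg (by linarith) (sq_nonneg _)
    have k4 : 0 < (b - s) * s ^ 2 := mul_pos (by linarith) (by positivity)
    nlinarith

lemma aux_ineq (b y D : ℝ) (hb : 0 < b) (hby : b ≤ y) (hD : 0 ≤ D) (hDy : D ≤ y * (y - b)) :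
    (2 * (b * (b + y)) + D) ^ 3 < 2 * y ^ 2 * (3 * (b * (b + y)) + D) ^ 2 := by
  have hy : 0 < y := by linarith
  set u := b * (b + y) with hu
  have hu0 : 0 < u := by positivity
  set X := 2 * u + D with hX
  set Z := y ^ 2 + b * y + 2 * b ^ 2 with hZ
  have hXZ : X ≤ Z := by nlinarith
  have hX0 : 0 < X := by linarith
  -- linear comparison
  have key : (3 * y ^ 2 + b * y + 2 * b ^ 2) * X ≤ 4 * y ^ 2 * (3 * u + D) := by
    have : (2 * b - y) * (b + y) * D ≤ 2 * (y - b) * (2 * b + 3 * y) * u := by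
      rcases le_total (2 * b) y with h | h
      · have : (2 * b - y) * (b + y) * D ≤ 0 := by
          have : 0 ≤ (y - 2 * b) * (b + y) * D :=
            mul_nonneg (mul_nonneg (by linarith) (by linarith)) hD
          linarith
        have : 0 ≤ 2 * (y - b) * (2 * b + 3 * y) * u := by
          have : 0 ≤ y - b := by linarith
          positivity
        linarith
      · have e1 : (2 * b - y) * (b + y) * D ≤ (2 * b - y) * (b + y) * (y * (y - b)) :=
          mul_le_mul_of_nonneg_left hDy (mul_nonneg (by linarith) (by linarith))
        have e2 : 0 ≤ (b + y) * (y - b) * (2 * b * (2 * b + 3 * y) - (2 * b - y) * y) := by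
          apply mul_nonneg (mul_nonneg (by linarith) (by linarith))
          nlinarith [mul_pos hb hy]
        rw [hu]; nlinarith
    nlinarith
  have sq : ((3 * y ^ 2 + b * y + 2 * b ^ 2) * X) ^ 2 ≤ (4 * y ^ 2 * (3 * u + D)) ^ 2 := by
    apply pow_le_pow_left₀ (by positivity) key
  -- AM-GM : 8 y² Z ≤ (Z + 2y²)²
  have am : 8 * y ^ 2 * Z * X ^ 2 ≤ ((3 * y ^ 2 + b * y + 2 * b ^ 2) * X) ^ 2 := by
    have : 0 ≤ (Z - 2 * y ^ 2) ^ 2 * X ^ 2 := by positivity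
    rw [hZ] at this ⊢; nlinarith
  have le1 : X ^ 3 ≤ Z * X ^ 2 := by nlinarith [mul_nonneg (sub_nonneg.2 hXZ) (sq_nonneg X)]
  have le2 : 8 * y ^ 2 * (Z * X ^ 2) ≤ 8 * y ^ 2 * (2 * y ^ 2 * (3 * u + D) ^ 2) := by
    nlinarith
  have le3 := le_of_mul_le_mul_left le2 (by positivity)
  refine lt_of_le_of_ne (le1.trans le3) ?_
  intro heq
  have z1 : Z * X ^ 2 = 2 * y ^ 2 * (3 * u + D) ^ 2 := le_antisymm le3 (by linarith)
  have z2 : (Z - 2 * y ^ 2) ^ 2 * X ^ 2 = 0 := by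
    apply le_antisymm _ (by positivity)
    have : 8 * y ^ 2 * (Z * X ^ 2) = 8 * y ^ 2 * (2 * y ^ 2 * (3 * u + D) ^ 2) := by rw [z1]
    rw [hZ] at this ⊢; nlinarith
  have z3 : Z - 2 * y ^ 2 = 0 := by
    rcases mul_eq_zero.1 z2 with h | h
    · exact pow_eq_zero_iff (two_ne_zero) |>.1 h
    · exact absurd h (by positivity)
  have z4 : Z = 2 * y ^ 2 := by linarith
  rw [z4] at z1
  have z5 : X ^ 2 = (3 * u + D) ^ 2 := by
    have : 2 * y ^ 2 ≠ 0 := by positivity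
    exact mul_left_cancel₀ this z1
  have : X ^ 2 < (3 * u + D) ^ 2 := by
    apply pow_lt_pow_left₀ _ hX0.le two_ne_zero
    linarith
  linarith

lemma aux_neg {ι : Type*} (T : Finset ι) (hT : T.Nonempty) (f : ι → ℝ) (a b s m : ℝ)
    (hb : b < 0) (hs : 0 < s) (hf : ∀ i ∈ T, f i ≤ b)
    (h1 : a + b + ∑ i ∈ T, f i = 0) (h2 : a ^ 2 + b ^ 2 + ∑ i ∈ T, f i ^ 2 = 2 * m)
    (h3 : a ^ 3 + b ^ 3 + ∑ i ∈ T, f i ^ 3 ≤ 2 * s ^ 3) : a ^ 2 + b ^ 2 < m + s ^ 2 := by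
  obtain ⟨c, rfl⟩ : ∃ c, b = -c := ⟨-b, by ring⟩
  have hc : 0 < c := by linarith
  set y := - ∑ i ∈ T, f i with hy
  have hyi : ∀ i ∈ T, - f i ≤ y := by
    intro i hi
    rw [hy, ← Finset.sum_neg_distrib]
    exact Finset.single_le_sum (f := fun i => - f i) (fun j hj => by linarith [hf j hj]) hi
  have hcy : c ≤ y := by
    obtain ⟨i, hi⟩ := hT
    linarith [hyi i hi, hf i hi]
  have ha : a = c + y := by linarith
  set Q := ∑ i ∈ T, f i ^ 2 with hQ
  have Q1 : Q ≤ y * y := by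
    have : y * y = ∑ i ∈ T, y * (- f i) := by
      rw [← Finset.mul_sum, Finset.sum_neg_distrib]
    rw [this]
    apply Finset.sum_le_sum
    intro i hi
    nlinarith [hyi i hi, hf i hi]
  have Q2 : c * y ≤ Q := by
    have : c * y = ∑ i ∈ T, c * (- f i) := by
      rw [← Finset.mul_sum, Finset.sum_neg_distrib]
    rw [this]
    apply Finset.sum_le_sum
    intro i hi
    nlinarith [hyi i hi, hf i hi]
  have C1 : -(y * Q) ≤ ∑ i ∈ T, f i ^ 3 := by
    rw [hQ, Finset.mul_sum, ← Finset.sum_neg_distrib]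
    apply Finset.sum_le_sum
    intro i hi
    nlinarith [mul_nonneg (sub_nonneg.2 (hyi i hi)) (sq_nonneg (f i))]
  have key := aux_ineq c y (y * y - Q) hc hcy (by linarith) (by linarith)
  by_contra! hcon
  subst ha
  have l1 : 2 * s ^ 2 ≤ 2 * (c * (c + y)) + (y * y - Q) := by nlinarith
  have l2 : y * (3 * (c * (c + y)) + (y * y - Q)) ≤ 2 * s ^ 3 := by nlinarith
  have l3 : (2 * s ^ 2) ^ 3 ≤ (2 * (c * (c + y)) + (y * y - Q)) ^ 3 :=
    pow_le_pow_left₀ (by positivity) l1 3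
  have l4 : (y * (3 * (c * (c + y)) + (y * y - Q))) ^ 2 ≤ (2 * s ^ 3) ^ 2 := by
    apply pow_le_pow_left₀ _ l2
    have : 0 < y := by linarith
    have : 0 ≤ y * y - Q := by linarith
    positivity
  nlinarith

lemma aux_trace_pow {V : Type*} [Fintype V] [DecidableEq V] (A : Matrix V V ℝ)
    (hA : A.IsHermitian) (k : ℕ) : (A ^ k).trace = ∑ v, hA.eigenvalues v ^ k := by
  conv_lhs => rw [hA.spectral_theorem, ← map_pow, Unitary.conjStarAlgAut_apply,
    Matrix.trace_mul_cycle, Unitary.coe_star_mul_self, one_mul, Matrix.diagonal_pow,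
    Matrix.trace_diagonal]
  simp

lemma aux_rayleigh {V : Type*} [Fintype V] [DecidableEq V] (A : Matrix V V ℝ)
    (hA : A.IsHermitian) (L : ℝ) (hL : ∀ v, hA.eigenvalues v ≤ L) (x : V → ℝ) :
    x ⬝ᵥ A.mulVec x ≤ L * (x ⬝ᵥ x) := by
  have hps : (L • (1 : Matrix V V ℝ) - A).PosSemidef := by
    have h0 : (Matrix.diagonal (fun v => L - hA.eigenvalues v)).PosSemidef :=
      Matrix.PosSemidef.diagonal fun v => by simpa using hL v
    have h1 := h0.mul_mul_conjTranspose_same (hA.eigenvectorUnitary : Matrix V V ℝ)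
    convert h1 using 1
    have e : Matrix.diagonal (fun v => L - hA.eigenvalues v)
        = L • (1 : Matrix V V ℝ) - Matrix.diagonal hA.eigenvalues := by
      ext i j
      by_cases h : i = j
      · subst h; simp
      · simp [h]
    rw [e, Matrix.mul_sub, Matrix.sub_mul]
    congr 1
    · rw [Matrix.mul_smul, Matrix.smul_mul, mul_one, ← Matrix.star_eq_conjTranspose,
        Unitary.mul_star_self_of_mem hA.eigenvectorUnitary.2]
    · conv_lhs => rw [hA.spectral_theorem, Unitary.conjStarAlgAut_apply]
      rfl
  have := hps.dotProduct_mulVec_nonneg x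
  simp only [star_trivial, Matrix.sub_mulVec, Matrix.smul_mulVec, Matrix.one_mulVec,
    dotProduct_sub, dotProduct_smul, smul_eq_mul] at this
  linarith

lemma aux_pf {V : Type*} [Fintype V] [DecidableEq V] (A : Matrix V V ℝ)
    (hA : A.IsHermitian) (hA0 : ∀ i j, 0 ≤ A i j)
    (L : ℝ) (hL : ∀ v, hA.eigenvalues v ≤ L) (v : V) : |hA.eigenvalues v| ≤ L := by
  set x : V → ℝ := (hA.eigenvectorBasis v).ofLp with hx
  have hev : A.mulVec x = hA.eigenvalues v • x := hA.mulVec_eigenvectorBasis v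
  have hxx : x ⬝ᵥ x = 1 := by
    have h := hA.eigenvectorBasis.orthonormal.1 v
    rw [EuclideanSpace.norm_eq, Real.sqrt_eq_one] at h
    rw [← h]
    simp [dotProduct, hx, sq]
  have h1 : x ⬝ᵥ A.mulVec x = hA.eigenvalues v := by
    rw [hev, dotProduct_smul, hxx]; simp
  have h2 := aux_rayleigh A hA L hL (fun i => |x i|)
  have h3 : (fun i => |x i|) ⬝ᵥ (fun i => |x i|) = 1 := by
    rw [← hxx]; simp [dotProduct]
  rw [h3, mul_one] at h2
  refine le_trans ?_ h2
  rw [← h1]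
  simp only [dotProduct, Matrix.mulVec]
  refine (Finset.abs_sum_le_sum_abs _ _).trans (Finset.sum_le_sum fun i _ => ?_)
  rw [abs_mul]
  refine mul_le_mul_of_nonneg_left ?_ (abs_nonneg _)
  refine (Finset.abs_sum_le_sum_abs _ _).trans (Finset.sum_le_sum fun j _ => ?_)
  rw [abs_mul, abs_of_nonneg (hA0 i j)]

lemma aux_tri {V : Type*} [Fintype V] [DecidableEq V]
    (G : SimpleGraph V) [DecidableRel G.Adj] :
    ((G.adjMatrix ℝ) ^ 3).trace ≤ 6 * ((G.cliqueFinset 3).card : ℝ) := by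
  set S : Finset (V × V × V) :=
    Finset.univ.filter fun p => G.Adj p.1 p.2.1 ∧ G.Adj p.2.1 p.2.2 ∧ G.Adj p.2.2 p.1 with hS
  have h1 : ((G.adjMatrix ℝ) ^ 3).trace = (S.card : ℝ) := by
    rw [hS, Finset.card_filter, Nat.cast_sum, Fintype.sum_prod_type]
    simp only [Matrix.trace, Matrix.diag, pow_three, Matrix.mul_apply,
      SimpleGraph.adjMatrix_apply]
    refine Finset.sum_congr rfl fun i _ => ?_
    rw [Fintype.sum_prod_type]
    refine Finset.sum_congr rfl fun j _ => ?_
    rw [Finset.mul_sum]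
    refine Finset.sum_congr rfl fun k _ => ?_
    by_cases a : G.Adj i j <;> by_cases b : G.Adj j k <;> by_cases c : G.Adj k i <;>
      simp [a, b, c]
  have h2 : S.card ≤ 6 * (G.cliqueFinset 3).card := by
    apply Finset.card_le_mul_card_image_of_maps_to
      (f := fun p : V × V × V => ({p.1, p.2.1, p.2.2} : Finset V))
    · rintro ⟨i, j, k⟩ hp
      simp only [hS, Finset.mem_filter, Finset.mem_univ, true_and] at hp
      rw [SimpleGraph.mem_cliqueFinset_iff, SimpleGraph.is3Clique_triple_iff]
      exact ⟨hp.1, hp.2.2.symm, hp.2.1⟩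
    · intro t ht
      rw [SimpleGraph.mem_cliqueFinset_iff, SimpleGraph.is3Clique_iff] at ht
      obtain ⟨a, b, c, hab, hac, hbc, rfl⟩ := ht
      refine le_trans (Finset.card_le_card (t :=
        {(a, b, c), (a, c, b), (b, a, c), (b, c, a), (c, a, b), (c, b, a)}) ?_)
        Finset.card_le_six
      rintro ⟨i, j, k⟩ hp
      simp only [hS, Finset.mem_filter, Finset.mem_univ, true_and] at hp
      obtain ⟨⟨hij, hjk, hki⟩, he⟩ := hp
      have hij := hij.ne
      have hjk := hjk.ne
      have hki := hki.ne
      have hi : i ∈ ({a, b, c} : Finset V) := by rw [← he]; simp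
      have hj : j ∈ ({a, b, c} : Finset V) := by rw [← he]; simp
      have hk : k ∈ ({a, b, c} : Finset V) := by rw [← he]; simp
      simp only [Finset.mem_insert, Finset.mem_singleton, Prod.mk.injEq] at hi hj hk ⊢
      clear he hS
      rcases hi with rfl | rfl | rfl <;> rcases hj with rfl | rfl | rfl <;>
        rcases hk with rfl | rfl | rfl <;> simp_all
  rw [h1]
  exact_mod_cast h2

theorem stmt_6 {V : Type*} [Fintype V] [DecidableEq V]
    (G : SimpleGraph V) [DecidableRel G.Adj]
    (m : ℕ) (hm : G.edgeFinset.card = m) (hm2 : 2 ≤ m)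
    (ht : 0 < (G.cliqueFinset 3).card)
    (μ : Fin (Fintype.card V) → ℝ) (hanti : Antitone μ)
    (hμ : ∃ e : V ≃ Fin (Fintype.card V),
      ∀ v, (adjMatrix_isHermitian G).eigenvalues v = μ (e v)) :
    ∀ h1 : 1 < Fintype.card V,
      μ ⟨0, by omega⟩ ^ 2 + μ ⟨1, h1⟩ ^ 2
        < (m : ℝ) + (3 * ((G.cliqueFinset 3).card : ℝ)) ^ ((2 : ℝ) / 3) := by
  intro h1
  obtain ⟨e, he⟩ := hμ
  have hcard : 2 < Fintype.card V := by
    obtain ⟨t, ht⟩ := Finset.card_pos.1 ht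
    rw [SimpleGraph.mem_cliqueFinset_iff] at ht
    have := ht.card_eq
    have := Finset.card_le_univ t
    omega
  set A := G.adjMatrix ℝ
  set hA := adjMatrix_isHermitian G
  set i0 : Fin (Fintype.card V) := ⟨0, by omega⟩ with hi0
  set i1 : Fin (Fintype.card V) := ⟨1, h1⟩ with hi1
  set t : ℝ := ((G.cliqueFinset 3).card : ℝ)
  have htp : 0 < t := Nat.cast_pos.2 ht
  set s : ℝ := (3 * t) ^ ((1 : ℝ) / 3)
  have hs : 0 < s := by positivity
  have hs2 : (3 * t) ^ ((2 : ℝ) / 3) = s ^ 2 := by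
    rw [← Real.rpow_natCast, ← Real.rpow_mul (by positivity)]; norm_num
  have hs3 : s ^ 3 = 3 * t := by
    rw [← Real.rpow_natCast, ← Real.rpow_mul (by positivity)]; norm_num
  set T : Finset (Fin (Fintype.card V)) := (Finset.univ.erase i0).erase i1 with hT
  have hne : i1 ≠ i0 := by simp [hi0, hi1, Fin.ext_iff]
  have split : ∀ k : ℕ, (A ^ k).trace = μ i0 ^ k + μ i1 ^ k + ∑ i ∈ T, μ i ^ k := by
    intro k
    rw [aux_trace_pow A hA k]
    simp_rw [he]
    rw [Equiv.sum_comp e (fun i => μ i ^ k), ← Finset.add_sum_erase _ _ (Finset.mem_univ i0),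
      ← Finset.add_sum_erase _ _ (Finset.mem_erase.2 ⟨hne, Finset.mem_univ i1⟩), add_assoc]
  have s1 := split 1
  have s2 := split 2
  have s3 := split 3
  have tr1 : (A ^ 1).trace = 0 := by rw [pow_one]; exact G.trace_adjMatrix ℝ
  have tr2 : (A ^ 2).trace = 2 * (m : ℝ) := by
    rw [sq, Matrix.trace]
    simp only [Matrix.diag, A, SimpleGraph.adjMatrix_mul_self_apply_self]
    rw [← hm]
    exact_mod_cast G.sum_degrees_eq_twice_card_edges
  have tr3 : (A ^ 3).trace ≤ 6 * t := aux_tri G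
  have hmax : ∀ v, hA.eigenvalues v ≤ μ i0 := by
    intro v
    rw [he]
    exact hanti (Fin.mk_le_of_le_val (Nat.zero_le _))
  have habs : ∀ i, |μ i| ≤ μ i0 := by
    intro i
    have := aux_pf A hA (fun i j => by
      simp only [A, SimpleGraph.adjMatrix_apply]; split_ifs <;> norm_num) (μ i0) hmax (e.symm i)
    rwa [he, Equiv.apply_symm_apply] at this
  have hba : μ i1 ≤ μ i0 := (le_abs_self _).trans (habs i1)
  rw [hs2]
  simp only [pow_one] at s1 tr1
  rcases le_or_gt 0 (μ i1) with hb | hb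
  · exact aux_pos T μ _ _ s m (hb.trans hba) hb hba hs (fun i _ => habs i)
      (by linarith) (by linarith) (by linarith)
  · refine aux_neg T ⟨⟨2, hcard⟩, by simp [hT, hi0, hi1, Fin.ext_iff]⟩ μ _ _ s m hb hs ?_
      (by linarith) (by linarith) (by linarith)
    intro i hi
    simp only [hT, hi0, hi1, Finset.mem_erase, Finset.mem_univ, and_true, ne_eq, Fin.ext_iff] at hi
    apply hanti
    rw [hi1, Fin.le_def]
    simp only
    omega
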